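/- Let U and Y be real Hilbert spaces, H : U → Y a bounded linear operator, Γ : Y → Y a bounded self-adjoint operator that is positive definite in the sense that there exists c > 0 with ⟨y, Γy⟩ ≥ c|y|² for all y ∈ Y, N ≥ 2, V̂ = (v̂^(1), …, v̂^(N)) ∈ U^N an ensemble with mean v̄̂, deviations dV̂ and covariance Ĉ = cov(V̂), and y ∈ Y. Let K = ĈH*(HĈH* + Γ)^{-1}, let T = (I_N + (1/(N−1))·dV̂*H*Γ^{-1}H·dV̂)^{-1/2} (the positive-definite inverse square root), let v̄ = v̄̂ + K(y − Hv̄̂), and define the analysis ensemble V with n-th member v^(n) = v̄ + ∑_{k=1}^N (v̂^(k) − v̄̂)T_{kn}. Then for each n, (I_U + ĈH*Γ^{-1}H)v^(n) = ∑_{k=1}^N v̂^(k)(T^{-1})_{kn} + ĈH*Γ^{-1}y. -/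

import Mathlib

open scoped RealInnerProductSpace
open ContinuousLinearMap

/-- The rank-one operator `u ⊗ v : w ↦ ⟨v, w⟩ u` on a real Hilbert space. -/
noncomputable def rankOne {U : Type*} [NormedAddCommGroup U] [InnerProductSpace ℝ U]
    (u v : U) : U →L[ℝ] U :=
  (innerSL ℝ v).smulRight u

open scoped Matrix

theorem isUnit_of_coercive' {Y : Type*} [NormedAddCommGroup Y] [InnerProductSpace ℝ Y]
    [CompleteSpace Y] (A : Y →L[ℝ] Y) (c : ℝ) (hc : 0 < c)
    (h : ∀ y : Y, c * ‖y‖ ^ 2 ≤ ⟪y, A y⟫) : IsUnit A := by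
  apply ContinuousLinearMap.isUnit_of_forall_le_norm_inner_map A (c := ⟨c, hc.le⟩) hc
  intro x
  have h1 := h x
  rw [real_inner_comm] at h1
  have h2 := le_abs_self (⟪A x, x⟫)
  rw [Real.norm_eq_abs]
  show ‖x‖ ^ 2 * c ≤ _
  linarith

/-- Lemma 2.5, equation (2.9): the ETKF analysis ensemble
`v⁽ⁿ⁾ = v̄ + ∑ₖ (v̂⁽ᵏ⁾ − v̄̂) Tₖₙ`, with `v̄ = v̄̂ + K(y − Hv̄̂)` and `T` the
positive-definite inverse square root of `I_N + (N−1)⁻¹ dV̂*H*Γ⁻¹H dV̂`, satisfies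
`(I + ĈH*Γ⁻¹H) v⁽ⁿ⁾ = ∑ₖ v̂⁽ᵏ⁾ (T⁻¹)ₖₙ + ĈH*Γ⁻¹ y` for every `n`. -/
theorem stmt6 {U Y : Type*} [NormedAddCommGroup U] [InnerProductSpace ℝ U] [CompleteSpace U]
    [NormedAddCommGroup Y] [InnerProductSpace ℝ Y] [CompleteSpace Y]
    (H : U →L[ℝ] Y)
    (Γ : Y →L[ℝ] Y) (hΓsa : IsSelfAdjoint Γ)
    (c : ℝ) (hc : 0 < c) (hΓpos : ∀ y : Y, c * ‖y‖ ^ 2 ≤ ⟪y, Γ y⟫)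
    (N : ℕ) (hN : 2 ≤ N) (Vh : Fin N → U) (y : Y)
    (vhbar : U) (hvhbar : vhbar = (N : ℝ)⁻¹ • ∑ n, Vh n)
    (dV : Fin N → U) (hdV : ∀ n, dV n = Vh n - vhbar)
    (Ch : U →L[ℝ] U) (hCh : Ch = ((N : ℝ) - 1)⁻¹ • ∑ n, rankOne (dV n) (dV n))
    (K : Y →L[ℝ] U)
    (hK : K = Ch ∘L adjoint H ∘L Ring.inverse (H ∘L Ch ∘L adjoint H + Γ))
    (T : Matrix (Fin N) (Fin N) ℝ) (hTpd : T.PosDef)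
    (hT : T * T * (1 + Matrix.of fun i j =>
      ((N : ℝ) - 1)⁻¹ * ⟪H (dV i), Ring.inverse Γ (H (dV j))⟫) = 1)
    (vbar : U) (hvbar : vbar = vhbar + K (y - H vhbar))
    (v : Fin N → U) (hv : ∀ n, v n = vbar + ∑ k, T k n • dV k) :
    ∀ n, (1 + Ch ∘L adjoint H ∘L Ring.inverse Γ ∘L H) (v n)
      = ∑ k, T⁻¹ k n • Vh k + (Ch ∘L adjoint H ∘L Ring.inverse Γ) y := by
  classical
  have hN1 : (0:ℝ) < ((N:ℝ) - 1)⁻¹ := by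
    have : (2:ℝ) ≤ N := by exact_mod_cast hN
    apply inv_pos.mpr; linarith
  have hCapp : ∀ u, Ch u = ((N : ℝ) - 1)⁻¹ • ∑ i, ⟪dV i, u⟫ • dV i := by
    intro u
    simp [hCh, rankOne, ContinuousLinearMap.sum_apply]
  have hΓu : IsUnit Γ := isUnit_of_coercive' Γ c hc hΓpos
  have hRu : IsUnit (H ∘L Ch ∘L adjoint H + Γ) := by
    apply isUnit_of_coercive' _ c hc
    intro z
    have h1 : 0 ≤ ⟪z, H (Ch (adjoint H z))⟫ := by
      rw [← adjoint_inner_left, hCapp, inner_smul_right, inner_sum]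
      apply mul_nonneg hN1.le
      apply Finset.sum_nonneg
      intro i _
      rw [inner_smul_right, real_inner_comm]
      exact mul_self_nonneg _
    have h2 := hΓpos z
    simp only [add_apply, coe_comp, Function.comp_apply, inner_add_right]
    linarith
  have hsum : ∑ i, dV i = 0 := by
    have hN0 : (N:ℝ) ≠ 0 := by positivity
    simp only [hdV, Finset.sum_sub_distrib, Finset.sum_const, Finset.card_univ, Fintype.card_fin]
    rw [hvhbar, ← Nat.cast_smul_eq_nsmul ℝ, smul_smul, mul_inv_cancel₀ hN0, one_smul, sub_self]
  set S : Matrix (Fin N) (Fin N) ℝ := Matrix.of fun i j =>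
      ((N : ℝ) - 1)⁻¹ * ⟪H (dV i), Ring.inverse Γ (H (dV j))⟫ with hS
  have hMT : (1 + S) * T * T = 1 := by
    rw [Matrix.mul_assoc]; exact mul_eq_one_comm.mp hT
  have hTinv : T⁻¹ = (1 + S) * T := Matrix.inv_eq_left_inv hMT
  have hone : (fun _ => (1:ℝ)) ᵥ* S = 0 := by
    ext j
    simp only [Matrix.vecMul, dotProduct, hS, Matrix.of_apply, one_mul, Pi.zero_apply]
    rw [← Finset.mul_sum, ← sum_inner, ← map_sum, hsum]
    simp
  set e : Fin N → ℝ := fun _ => (1:ℝ) with he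
  have heM : e ᵥ* (1 + S) = e := by
    rw [Matrix.vecMul_add, hone, Matrix.vecMul_one, add_zero]
  have heTT : (e ᵥ* T) ᵥ* T = e := by
    have h := congrArg (fun A => e ᵥ* A) hMT
    simp only [Matrix.vecMul_one] at h
    rwa [← Matrix.vecMul_vecMul, ← Matrix.vecMul_vecMul, heM] at h
  have heT : e ᵥ* T = e := by
    have hpd : (T + 1).PosDef := hTpd.add Matrix.PosDef.one
    have hu : IsUnit (T + 1) := hpd.isUnit
    have h0 : (e ᵥ* T) ᵥ* (T + 1) = e ᵥ* (T + 1) := by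
      rw [Matrix.vecMul_add, Matrix.vecMul_add, heTT, Matrix.vecMul_one, Matrix.vecMul_one, add_comm]
    exact Matrix.vecMul_injective_of_isUnit hu h0
  have heTi : ∀ n, ∑ i, T⁻¹ i n = 1 := by
    intro n
    have h : (e ᵥ* T⁻¹) n = 1 := by
      rw [hTinv, ← Matrix.vecMul_vecMul, heM, heT]
    simpa [Matrix.vecMul, dotProduct, he] using h
  have hA : ∀ k, (1 + Ch ∘L adjoint H ∘L Ring.inverse Γ ∘L H) (dV k) = ∑ i, (1 + S) i k • dV i := by
    intro k
    simp only [add_apply, coe_comp, Function.comp_apply, one_apply_eq_self, Matrix.add_apply, add_smul,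
      Finset.sum_add_distrib, hCapp, adjoint_inner_right, Finset.smul_sum, smul_smul]
    congr 1
    simp [Matrix.one_apply, ite_smul]
  have hΓi : ∀ z, Ring.inverse Γ (Γ z) = z := fun z =>
    congrArg (fun A : Y →L[ℝ] Y => A z) (Ring.inverse_mul_cancel Γ hΓu)
  have hRi : ∀ z, (H ∘L Ch ∘L adjoint H + Γ) (Ring.inverse (H ∘L Ch ∘L adjoint H + Γ) z) = z :=
    fun z => congrArg (fun A : Y →L[ℝ] Y => A z) (Ring.mul_inverse_cancel _ hRu)
  have hKz : ∀ z, (1 + Ch ∘L adjoint H ∘L Ring.inverse Γ ∘L H) (K z)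
      = (Ch ∘L adjoint H ∘L Ring.inverse Γ) z := by
    intro z
    have h1 := hRi z
    rw [hK]
    simp only [add_apply, coe_comp, Function.comp_apply, one_apply_eq_self] at h1 ⊢
    generalize Ring.inverse (H ∘L Ch ∘L adjoint H + Γ) z = w at h1 ⊢
    rw [← h1, map_add, hΓi, map_add, map_add, add_comm]
  intro n
  have hdev : (1 + Ch ∘L adjoint H ∘L Ring.inverse Γ ∘L H) (∑ k, T k n • dV k)
      = ∑ k, T⁻¹ k n • Vh k - vhbar := by
    have h1 : ∑ k, T⁻¹ k n • Vh k - vhbar = ∑ k, T⁻¹ k n • dV k := by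
      simp only [hdV, smul_sub, Finset.sum_sub_distrib]
      rw [← Finset.sum_smul, heTi, one_smul]
    rw [h1, map_sum, hTinv]
    simp only [map_smul, hA, Matrix.mul_apply, Finset.sum_smul, Finset.smul_sum, smul_smul]
    rw [Finset.sum_comm]
    simp only [mul_comm]
  rw [hv, map_add, hdev, hvbar, map_add, hKz, map_sub]
  simp only [add_apply, coe_comp, Function.comp_apply, one_apply_eq_self]
  abel
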